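/- arXiv:2008.08546 — 4 statements merged into one kernel-verified Lean document; each statement's English description precedes it below -/
import Mathlib

section
/- The semi-tensor product of real matrices is associative: for any real matrices A, B, C (of arbitrary sizes), A⋉(B⋉C) = (A⋉B)⋉C. -/
open Matrix Kronecker

/-- Semi-tensor product of real matrices:
`A ⋉ B := (A ⊗ I_{t/n})(B ⊗ I_{t/p})` where `t = lcm(n, p)`. -/
noncomputable def stp {m n p q : ℕ} (A : Matrix (Fin m) (Fin n) ℝ)
    (B : Matrix (Fin p) (Fin q) ℝ) :
    Matrix (Fin (m * (Nat.lcm n p / n))) (Fin (q * (Nat.lcm n p / p))) ℝ :=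
  (Matrix.reindex finProdFinEquiv
      (finProdFinEquiv.trans (finCongr (Nat.mul_div_cancel' (Nat.dvd_lcm_left n p))))
      (A ⊗ₖ (1 : Matrix (Fin (Nat.lcm n p / n)) (Fin (Nat.lcm n p / n)) ℝ))) *
  (Matrix.reindex
      (finProdFinEquiv.trans (finCongr (Nat.mul_div_cancel' (Nat.dvd_lcm_right n p))))
      finProdFinEquiv
      (B ⊗ₖ (1 : Matrix (Fin (Nat.lcm n p / p)) (Fin (Nat.lcm n p / p)) ℝ)))

/-- The Kronecker product `A ⊗ I_k`, with rows indexed by any `Fin M` with `M = m * k` and columns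
indexed by any `Fin N` with `N = n * k`. -/
noncomputable def kronOne {m n : ℕ} (A : Matrix (Fin m) (Fin n) ℝ) (k : ℕ) {M N : ℕ}
    (hM : M = m * k) (hN : N = n * k) : Matrix (Fin M) (Fin N) ℝ :=
  (A ⊗ₖ (1 : Matrix (Fin k) (Fin k) ℝ)).submatrix
    ((finCongr hM).trans finProdFinEquiv.symm) ((finCongr hN).trans finProdFinEquiv.symm)

theorem stp_eq_kronOne_mul {m n p q : ℕ} (A : Matrix (Fin m) (Fin n) ℝ)
    (B : Matrix (Fin p) (Fin q) ℝ) :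
    stp A B =
      kronOne A (Nat.lcm n p / n) rfl (Nat.mul_div_cancel' (Nat.dvd_lcm_left n p)).symm *
      kronOne B (Nat.lcm n p / p) (Nat.mul_div_cancel' (Nat.dvd_lcm_right n p)).symm rfl :=
  rfl

theorem kronOne_mul {m n p : ℕ} (A : Matrix (Fin m) (Fin n) ℝ) (B : Matrix (Fin n) (Fin p) ℝ)
    (k : ℕ) {M P : ℕ} (hM : M = m * k) (hP : P = p * k) {N : ℕ} (hN : N = n * k) :
    kronOne (A * B) k hM hP = kronOne A k hM hN * kronOne B k hN hP := by
  simp only [kronOne]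
  rw [Matrix.submatrix_mul_equiv, ← Matrix.mul_kronecker_mul, Matrix.one_mul]

theorem kronOne_apply {m n : ℕ} (A : Matrix (Fin m) (Fin n) ℝ) (k : ℕ) {M N : ℕ}
    (hM : M = m * k) (hN : N = n * k) (i : Fin M) (j : Fin N) :
    kronOne A k hM hN i j =
      if (i : ℕ) % k = j % k then
        A ⟨i / k, Nat.div_lt_of_lt_mul (by rw [Nat.mul_comm, ← hM]; exact i.2)⟩
          ⟨j / k, Nat.div_lt_of_lt_mul (by rw [Nat.mul_comm, ← hN]; exact j.2)⟩
      else 0 := by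
  subst hM hN
  simp [kronOne, Matrix.one_apply, Fin.ext_iff, Fin.divNat, Fin.modNat]

theorem kronOne_kronOne {m n : ℕ} (A : Matrix (Fin m) (Fin n) ℝ) (k l : ℕ) {M N M' N' : ℕ}
    (hM : M = m * k) (hN : N = n * k) (hM' : M' = M * l) (hN' : N' = N * l) :
    kronOne (kronOne A k hM hN) l hM' hN' =
      kronOne A (l * k) (by rw [hM', hM, Nat.mul_assoc, Nat.mul_comm k])
        (by rw [hN', hN, Nat.mul_assoc, Nat.mul_comm k]) := by
  ext i j
  have hl : 0 < l := by
    rcases Nat.eq_zero_or_pos l with rfl | h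
    · exact absurd i.2 (by simp [hM'])
    · exact h
  have key : (i : ℕ) % (l * k) = j % (l * k) ↔
      (i : ℕ) % l = j % l ∧ (i : ℕ) / l % k = j / l % k := by
    constructor
    · intro h
      refine ⟨?_, ?_⟩
      · rw [← Nat.mod_mul_right_mod (i : ℕ) l k, h, Nat.mod_mul_right_mod]
      · rw [← Nat.mod_mul_right_div_self, h, Nat.mod_mul_right_div_self]
    · rintro ⟨h₁, h₂⟩
      rw [Nat.mod_mul, Nat.mod_mul, h₁, h₂]
  simp only [kronOne_apply, key, Nat.div_div_eq_div_mul, ite_and]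

theorem kronOne_mul_assoc_heq {m n p q r s : ℕ} (A : Matrix (Fin m) (Fin n) ℝ)
    (B : Matrix (Fin p) (Fin q) ℝ) (C : Matrix (Fin r) (Fin s) ℝ)
    {a b c a' b' c' : ℕ} (ha : a = a') (hb : b = b') (hc : c = c')
    {M N P Q M' N' P' Q' : ℕ} (hM : M = m * a) (hN : N = n * a) (hN₂ : N = p * b)
    (hP : P = q * b) (hP₂ : P = r * c) (hQ : Q = s * c)
    (hM' : M' = m * a') (hN' : N' = n * a') (hN₂' : N' = p * b')
    (hP' : P' = q * b') (hP₂' : P' = r * c') (hQ' : Q' = s * c') :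
    HEq (kronOne A a hM hN * (kronOne B b hN₂ hP * kronOne C c hP₂ hQ))
      (kronOne A a' hM' hN' * kronOne B b' hN₂' hP' * kronOne C c' hP₂' hQ') := by
  subst ha hb hc hM hN hP hQ hM' hN' hP' hQ'
  rw [Matrix.mul_assoc]

/-- The multipliers of the three factors agree in the two bracketings: with `b = u / q`,
`c = u / r` for `u = lcm q r` and `a = v / n`, `d = v / p` for `v = lcm n p`. -/
theorem lcm_multipliers_eq {n p q r a b c d α β γ δ : ℕ}
    (hn : 0 < n) (hp : 0 < p) (hq : 0 < q) (hr : 0 < r)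
    (hb : q * b = Nat.lcm q r) (hc : r * c = Nat.lcm q r)
    (ha : n * a = Nat.lcm n p) (hd : p * d = Nat.lcm n p)
    (hα : n * α = Nat.lcm n (p * b)) (hβ : p * b * β = Nat.lcm n (p * b))
    (hγ : q * d * γ = Nat.lcm (q * d) r) (hδ : r * δ = Nat.lcm (q * d) r) :
    α = γ * a ∧ β * b = γ * d ∧ β * c = δ := by
  have hT : q * Nat.lcm n (p * b) = p * Nat.lcm (q * d) r := by
    rw [← Nat.lcm_mul_left, ← Nat.lcm_mul_left, Nat.mul_left_comm q p b, hb,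
      Nat.mul_left_comm p q d, hd, ← Nat.lcm_mul_left, ← Nat.lcm_mul_left, Nat.mul_comm p q,
      Nat.lcm_assoc]
  have hbd : β * b = γ * d := by
    apply Nat.eq_of_mul_eq_mul_left (Nat.mul_pos hp hq)
    rw [← hβ, ← hγ] at hT
    linarith
  refine ⟨?_, hbd, ?_⟩
  · apply Nat.eq_of_mul_eq_mul_left hn
    calc n * α = p * (β * b) := by rw [hα, ← hβ]; ring
      _ = γ * (p * d) := by rw [hbd]; ring
      _ = n * (γ * a) := by rw [hd, ← ha]; ring
  · apply Nat.eq_of_mul_eq_mul_left hr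
    calc r * (β * c) = β * (r * c) := by ring
      _ = q * (β * b) := by rw [hc, ← hb]; ring
      _ = r * δ := by rw [hbd, hδ, ← hγ]; ring

/-- The semi-tensor product of real matrices is associative:
`A ⋉ (B ⋉ C) = (A ⋉ B) ⋉ C` (the two sides have the same dimensions, which is
expressed here via heterogeneous equality). -/
theorem stp_assoc {m n p q r s : ℕ}
    (hm : 0 < m) (hn : 0 < n) (hp : 0 < p) (hq : 0 < q) (hr : 0 < r) (hs : 0 < s)
    (A : Matrix (Fin m) (Fin n) ℝ) (B : Matrix (Fin p) (Fin q) ℝ)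
    (C : Matrix (Fin r) (Fin s) ℝ) :
    HEq (stp A (stp B C)) (stp (stp A B) C) := by
  rw [stp_eq_kronOne_mul A (stp B C), stp_eq_kronOne_mul (stp A B) C,
    stp_eq_kronOne_mul B C, stp_eq_kronOne_mul A B,
    kronOne_mul _ _ _ _ _ rfl, kronOne_mul _ _ _ _ _ rfl]
  simp only [kronOne_kronOne]
  obtain ⟨h₁, h₂, h₃⟩ := lcm_multipliers_eq hn hp hq hr
    (Nat.mul_div_cancel' (Nat.dvd_lcm_left q r)) (Nat.mul_div_cancel' (Nat.dvd_lcm_right q r))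
    (Nat.mul_div_cancel' (Nat.dvd_lcm_left n p)) (Nat.mul_div_cancel' (Nat.dvd_lcm_right n p))
    (Nat.mul_div_cancel' (Nat.dvd_lcm_left _ _)) (Nat.mul_div_cancel' (Nat.dvd_lcm_right _ _))
    (Nat.mul_div_cancel' (Nat.dvd_lcm_left _ _)) (Nat.mul_div_cancel' (Nat.dvd_lcm_right _ _))
  exact kronOne_mul_assoc_heq A B C h₁ h₂ h₃ _ _ _ _ _ _ _ _ _ _ _ _
end

section
/- The semi-tensor product of two logical matrices is a logical matrix: if A is an m×n logical matrix and B is a p×q logical matrix, then every column of A⋉B is a column of the identity matrix of the appropriate size. -/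
open Matrix Kronecker

/-- A real matrix is a logical matrix if each of its columns is a column of the
identity matrix (i.e. a standard basis vector). -/
def IsLogicalMatrix {m n : ℕ} (L : Matrix (Fin m) (Fin n) ℝ) : Prop :=
  ∀ j : Fin n, ∃ i : Fin m, ∀ k : Fin m, L k j = if k = i then 1 else 0

/-- The product of two matrices whose columns are standard basis vectors is of the same kind,
with the column indices composed. -/
theorem mul_apply_of_forall_col_eq_ite {l m n R : Type*} [Fintype m] [DecidableEq l]
    [DecidableEq m] [NonAssocSemiring R] {M : Matrix l m R} {N : Matrix m n R} {f : m → l}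
    {g : n → m} (hM : ∀ i j, M i j = if i = f j then 1 else 0)
    (hN : ∀ i j, N i j = if i = g j then 1 else 0) (i : l) (j : n) :
    (M * N) i j = if i = f (g j) then 1 else 0 := by
  simp [Matrix.mul_apply, hM, hN]

/-- The Kronecker product with an identity matrix of a matrix whose columns are standard basis
vectors is of the same kind, also after reindexing. -/
theorem reindex_kronecker_one_apply_of_forall_col_eq_ite {m n k m' n' R : Type*}
    [DecidableEq m] [DecidableEq k] [DecidableEq m'] [NonAssocSemiring R]
    (e₁ : m × k ≃ m') (e₂ : n × k ≃ n') {M : Matrix m n R} {f : n → m}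
    (hM : ∀ i j, M i j = if i = f j then 1 else 0) (i : m') (j : n') :
    Matrix.reindex e₁ e₂ (M ⊗ₖ (1 : Matrix k k R)) i j =
      if i = e₁ (f (e₂.symm j).1, (e₂.symm j).2) then 1 else 0 := by
  simp [Matrix.kroneckerMap_apply, hM, Matrix.one_apply, ← e₁.symm_apply_eq, Prod.ext_iff,
    ← ite_and, and_comm]

/-- The semi-tensor product of two logical matrices is a logical matrix. -/
theorem stp_isLogicalMatrix {m n p q : ℕ}
    (A : Matrix (Fin m) (Fin n) ℝ) (B : Matrix (Fin p) (Fin q) ℝ)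
    (hA : IsLogicalMatrix A) (hB : IsLogicalMatrix B) :
    IsLogicalMatrix (stp A B) := by
  choose f hf using hA
  choose g hg using hB
  exact fun j => ⟨_, fun k => mul_apply_of_forall_col_eq_ite
    (reindex_kronecker_one_apply_of_forall_col_eq_ite _ _ fun i j => hf j i)
    (reindex_kronecker_one_apply_of_forall_col_eq_ite _ _ fun i j => hg j i) k j⟩
end

section
/- Every Boolean function f : Boolⁿ → Bool has a unique structure matrix: there exists exactly one 2×2ⁿ logical matrix M_f such that for all Boolean values x₁,…,xₙ, v(f(x₁,…,xₙ)) = M_f ⋉ v(x₁) ⋉ ⋯ ⋉ v(xₙ). -/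
open Matrix Kronecker

/-- Vector encoding of Booleans: `true ↦ δ₂¹ = (1,0)ᵀ`, `false ↦ δ₂² = (0,1)ᵀ`. -/
def vB (b : Bool) : Matrix (Fin 2) (Fin 1) ℝ :=
  Matrix.of fun i _ => if i = (if b then (0 : Fin 2) else 1) then 1 else 0

/-- The iterated semi-tensor product `v(x₁) ⋉ v(x₂) ⋉ ⋯ ⋉ v(xₖ)` of the vector
encodings of a tuple of Booleans. -/
noncomputable def vecs : (k : ℕ) → (Fin k → Bool) → Matrix (Fin (2 ^ k)) (Fin 1) ℝ
  | 0, _ => Matrix.of fun _ _ => (1 : ℝ)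
  | k + 1, x =>
    Matrix.reindex
      (finCongr (show 2 * (Nat.lcm 1 (2 ^ k) / 1) = 2 ^ (k + 1) by
        rw [Nat.lcm_one_left, Nat.div_one, pow_succ]; ring))
      (finCongr (show 1 * (Nat.lcm 1 (2 ^ k) / 2 ^ k) = 1 by
        rw [Nat.lcm_one_left, Nat.div_self (Nat.two_pow_pos k), one_mul]))
      (stp (vB (x 0)) (vecs k (fun i => x i.succ)))

/-- Without padding, the semi-tensor product is the ordinary matrix product. -/
theorem reindex_kronecker_mul_of_eq_one {m n q a b t : ℕ} (M : Matrix (Fin m) (Fin n) ℝ)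
    (B : Matrix (Fin n) (Fin q) ℝ) (ha : a = 1) (hb : b = 1) (hn : n * a = t) (hp : n * b = t)
    (i : Fin (m * a)) (j : Fin (q * b)) :
    (Matrix.reindex finProdFinEquiv (finProdFinEquiv.trans (finCongr hn))
        (M ⊗ₖ (1 : Matrix (Fin a) (Fin a) ℝ)) *
      Matrix.reindex (finProdFinEquiv.trans (finCongr hp)) finProdFinEquiv
        (B ⊗ₖ (1 : Matrix (Fin b) (Fin b) ℝ))) i j =
    (M * B) (finProdFinEquiv.symm i).1 (finProdFinEquiv.symm j).1 := by
  subst ha hb hn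
  rw [Matrix.mul_apply, Matrix.mul_apply, ← finProdFinEquiv.sum_comp, Fintype.sum_prod_type]
  refine Finset.sum_congr rfl fun l _ => ?_
  simp [Matrix.kroneckerMap_apply, -finProdFinEquiv_symm_apply, -finProdFinEquiv_apply_val,
    Matrix.one_apply, eq_iff_true_of_subsingleton]

/-- The semi-tensor product with a column on the left is the Kronecker product. -/
theorem reindex_kronecker_mul_of_col {m p q a b t : ℕ} (A : Matrix (Fin m) (Fin 1) ℝ)
    (B : Matrix (Fin p) (Fin q) ℝ) (ha : a = p) (hb : b = 1) (hn : 1 * a = t) (hp : p * b = t)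
    (i : Fin (m * a)) (j : Fin (q * b)) :
    (Matrix.reindex finProdFinEquiv (finProdFinEquiv.trans (finCongr hn))
        (A ⊗ₖ (1 : Matrix (Fin a) (Fin a) ℝ)) *
      Matrix.reindex (finProdFinEquiv.trans (finCongr hp)) finProdFinEquiv
        (B ⊗ₖ (1 : Matrix (Fin b) (Fin b) ℝ))) i j =
    A (finProdFinEquiv.symm i).1 0 *
      B (finCongr ha (finProdFinEquiv.symm i).2) (finProdFinEquiv.symm j).1 := by
  subst ha hb hp
  rw [Matrix.mul_apply, ← finProdFinEquiv.sum_comp, Fintype.sum_prod_type]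
  have h (l : Fin a) : Fin.cast hn.symm (finProdFinEquiv (l, (0 : Fin 1))) =
      finProdFinEquiv ((0 : Fin 1), l) := by
    ext; simp
  simp [Matrix.kroneckerMap_apply, -finProdFinEquiv_symm_apply, -finProdFinEquiv_apply_val,
    Matrix.one_apply, Subsingleton.elim _ (0 : Fin 1), h]

/-- The products `v(x₁) ⋉ ⋯ ⋉ v(xₖ)` enumerate the standard basis of `ℝ^(2^k)`. -/
theorem exists_equiv_vecs (k : ℕ) : ∃ e : (Fin k → Bool) ≃ Fin (2 ^ k),
    ∀ x i j, vecs k x i j = if i = e x then 1 else 0 := by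
  induction k with
  | zero =>
    have : Unique (Fin (2 ^ 0)) := inferInstanceAs (Unique (Fin 1))
    exact ⟨Equiv.ofUnique _ _, fun x i j => by
      simp [vecs, Subsingleton.elim i (Equiv.ofUnique _ _ x)]⟩
  | succ k ih =>
    obtain ⟨e, he⟩ := ih
    let bit : Bool ≃ Fin 2 := Equiv.boolNot.trans finTwoEquiv.symm
    have hbit (b : Bool) (i : Fin 2) (j : Fin 1) : vB b i j = if i = bit b then 1 else 0 := by
      cases b <;> rfl
    have hpow : 2 * 2 ^ k = 2 ^ (k + 1) := by rw [pow_succ, mul_comm]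
    refine ⟨(Fin.consEquiv fun _ => Bool).symm.trans ((bit.prodCongr e).trans
      (finProdFinEquiv.trans (finCongr hpow))), fun x i j => ?_⟩
    have ha : Nat.lcm 1 (2 ^ k) / 1 = 2 ^ k := by simp
    have hb : Nat.lcm 1 (2 ^ k) / 2 ^ k = 1 := by simp
    obtain ⟨⟨u, v⟩, rfl⟩ := (finProdFinEquiv.trans (finCongr hpow)).surjective i
    have hi (h) : (finCongr h).symm ((finProdFinEquiv.trans (finCongr hpow)) (u, v)) =
        finProdFinEquiv (u, (finCongr ha).symm v) := by
      ext; simp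
    rw [vecs, Matrix.reindex_apply, Matrix.submatrix_apply, stp,
      reindex_kronecker_mul_of_col _ _ ha hb, hbit, he, hi]
    simp only [Equiv.symm_apply_apply, Equiv.apply_symm_apply, Equiv.trans_apply,
      EmbeddingLike.apply_eq_iff_eq, Equiv.prodCongr_apply, Prod.map, Prod.mk.injEq]
    have htail : (fun i => x (Fin.succ i)) = Fin.tail x := rfl
    by_cases hu : u = bit (x 0) <;> simp [hu, Fin.consEquiv, htail]

/-- Every Boolean function `f : Boolⁿ → Bool` has a unique structure matrix: there is
exactly one `2 × 2ⁿ` logical matrix `M` with `v(f(x₁,…,xₙ)) = M ⋉ v(x₁) ⋉ ⋯ ⋉ v(xₙ)`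
for all Booleans `x₁, …, xₙ`. -/
theorem structure_matrix_exists_unique {n : ℕ} (f : (Fin n → Bool) → Bool) :
    ∃! M : Matrix (Fin 2) (Fin (2 ^ n)) ℝ, IsLogicalMatrix M ∧
      ∀ x : Fin n → Bool,
        vB (f x) =
          Matrix.reindex
            (finCongr (show 2 * (Nat.lcm (2 ^ n) (2 ^ n) / 2 ^ n) = 2 by
              rw [Nat.lcm_self, Nat.div_self (Nat.two_pow_pos n), mul_one]))
            (finCongr (show 1 * (Nat.lcm (2 ^ n) (2 ^ n) / 2 ^ n) = 1 by
              rw [Nat.lcm_self, Nat.div_self (Nat.two_pow_pos n), mul_one]))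
            (stp M (vecs n x)) := by
  obtain ⟨e, he⟩ := exists_equiv_vecs n
  have h1 : Nat.lcm (2 ^ n) (2 ^ n) / 2 ^ n = 1 := by simp
  have key (M : Matrix (Fin 2) (Fin (2 ^ n)) ℝ) (x : Fin n → Bool) (h₂ h₁) :
      Matrix.reindex (finCongr h₂) (finCongr h₁) (stp M (vecs n x)) =
        Matrix.of fun i (_ : Fin 1) => M i (e x) := by
    ext i j
    have hi : (finProdFinEquiv.symm ((finCongr h₂).symm i)).1 = i := by
      ext; simp [Fin.divNat]
    rw [Matrix.reindex_apply, Matrix.submatrix_apply, stp,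
      reindex_kronecker_mul_of_eq_one _ _ h1 h1, Matrix.mul_apply, hi]
    simp [he]
  simp only [key]
  refine ⟨Matrix.of fun i j => vB (f (e.symm j)) i 0, ⟨fun j => ⟨_, fun _ => rfl⟩, fun x => ?_⟩,
    fun M hM => ?_⟩
  · ext i j
    simp [Subsingleton.elim j 0]
  · ext i j
    simp [hM.2]
end

section
/- The block-rearrangement identity used in the state-transition derivation holds: for all column vectors p₁,…,pₙ ∈ ℝ² and q₁,…,q_m ∈ ℝ² (with m ≥ 1), p₁ ⋉ ⋯ ⋉ pₙ ⋉ q₁ ⋉ ⋯ ⋉ q_m = W_{[2,2ⁿ]} ⋉ (∏_{i=1}^{m−1} (I_{2ⁱ} ⊗ W_{[2,2ⁿ]})) ⋉ q₁ ⋉ ⋯ ⋉ q_m ⋉ p₁ ⋉ ⋯ ⋉ pₙ. -/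
open Matrix Kronecker

/-- The swap (commutation) matrix `W_{[m,n]}`: with 0-based indices, its column
`i·n + j` (for `i < m`, `j < n`) is the standard basis vector `δ_{mn}^{j·m + i}`. -/
def swapMatrix (m n : ℕ) : Matrix (Fin (m * n)) (Fin (m * n)) ℝ :=
  Matrix.of fun r c => if (r : ℕ) = ((c : ℕ) % n) * m + (c : ℕ) / n then 1 else 0

/-- The iterated semi-tensor product `v₁ ⋉ v₂ ⋉ ⋯ ⋉ vₖ` of a tuple of column
vectors in `ℝ²`. -/
noncomputable def stpVecs : (k : ℕ) → (Fin k → Matrix (Fin 2) (Fin 1) ℝ) →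
    Matrix (Fin (2 ^ k)) (Fin 1) ℝ
  | 0, _ => Matrix.of fun _ _ => (1 : ℝ)
  | k + 1, v =>
    Matrix.reindex
      (finCongr (show 2 * (Nat.lcm 1 (2 ^ k) / 1) = 2 ^ (k + 1) by
        rw [Nat.lcm_one_left, Nat.div_one, pow_succ]; ring))
      (finCongr (show 1 * (Nat.lcm 1 (2 ^ k) / 2 ^ k) = 1 by
        rw [Nat.lcm_one_left, Nat.div_self (Nat.two_pow_pos k), one_mul]))
      (stp (v 0) (stpVecs k (fun i => v i.succ)))

/-- The factor `I_{2ⁱ} ⊗ W_{[2,2ⁿ]}`, as a square matrix of size `2ⁱ·(2·2ⁿ)`. -/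
noncomputable def swapFactor (n i : ℕ) :
    Matrix (Fin (2 ^ i * (2 * 2 ^ n))) (Fin (2 ^ i * (2 * 2 ^ n))) ℝ :=
  Matrix.reindex finProdFinEquiv finProdFinEquiv
    ((1 : Matrix (Fin (2 ^ i)) (Fin (2 ^ i)) ℝ) ⊗ₖ swapMatrix 2 (2 ^ n))

/-- `Nat.lcm a b = b` whenever `a ∣ b`. -/
theorem lcm_eq_right_of_dvd {a b : ℕ} (h : a ∣ b) : Nat.lcm a b = b :=
  Nat.dvd_antisymm (Nat.lcm_dvd h dvd_rfl) (Nat.dvd_lcm_right a b)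

/-- The semi-tensor product `∏_{i=1}^{k} (I_{2ⁱ} ⊗ W_{[2,2ⁿ]})`, taken in increasing
order of `i` (with the empty product, `k = 0`, being the identity `I_{2^{n+1}}`);
it is a square matrix of size `2^{n+1}·2^k`. -/
noncomputable def bigSwapProd (n : ℕ) : (k : ℕ) →
    Matrix (Fin (2 ^ (n + 1) * 2 ^ k)) (Fin (2 ^ (n + 1) * 2 ^ k)) ℝ
  | 0 => 1
  | k + 1 =>
    Matrix.reindex
      (finCongr (by
        have hab : 2 ^ (n + 1) * 2 ^ k ∣ 2 ^ (k + 1) * (2 * 2 ^ n) := ⟨2, by ring⟩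
        rw [lcm_eq_right_of_dvd hab,
          show 2 ^ (k + 1) * (2 * 2 ^ n) = 2 ^ (n + 1) * 2 ^ k * 2 by ring,
          Nat.mul_div_cancel_left 2 (by positivity), pow_succ]
        ring))
      (finCongr (by
        have hab : 2 ^ (n + 1) * 2 ^ k ∣ 2 ^ (k + 1) * (2 * 2 ^ n) := ⟨2, by ring⟩
        rw [lcm_eq_right_of_dvd hab, Nat.div_self (by positivity), mul_one, pow_succ]
        ring))
      (stp (bigSwapProd n k) (swapFactor n (k + 1)))

/-- The extension by zero of a matrix to all pairs of natural-number indices. -/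
noncomputable def zeroExt {m n : ℕ} (A : Matrix (Fin m) (Fin n) ℝ) (r c : ℕ) : ℝ :=
  if h : r < m ∧ c < n then A ⟨r, h.1⟩ ⟨c, h.2⟩ else 0

theorem zeroExt_val {m n : ℕ} (A : Matrix (Fin m) (Fin n) ℝ) (i : Fin m) (j : Fin n) :
    zeroExt A i j = A i j := by
  simp [zeroExt]

theorem heq_of_zeroExt {m n m' n' : ℕ} (hm : m = m') (hn : n = n')
    {A : Matrix (Fin m) (Fin n) ℝ} {B : Matrix (Fin m') (Fin n') ℝ}
    (h : ∀ r < m, ∀ c < n, zeroExt A r c = zeroExt B r c) : HEq A B := by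
  subst hm hn
  refine heq_of_eq (Matrix.ext fun i j => ?_)
  rw [← zeroExt_val A, ← zeroExt_val B, h i i.2 j j.2]

/-- The entries of `A ⋉ B`, where `s` and `u` are the two scaling factors. -/
theorem zeroExt_stp {m n p q s u t : ℕ} (A : Matrix (Fin m) (Fin n) ℝ)
    (B : Matrix (Fin p) (Fin q) ℝ) (ht : Nat.lcm n p = t) (hs : n * s = t) (hu : p * u = t)
    (ht0 : 0 < t) (r c : ℕ) :
    zeroExt (stp A B) r c = ∑ k ∈ Finset.range t,
      (if r % s = k % s then zeroExt A (r / s) (k / s) else 0) *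
        (if k % u = c % u then zeroExt B (k / u) (c / u) else 0) := by
  have hn0 : 0 < n := Nat.pos_of_ne_zero (by rintro rfl; simp at hs; omega)
  have hp0 : 0 < p := Nat.pos_of_ne_zero (by rintro rfl; simp at hu; omega)
  have hs0 : 0 < s := Nat.pos_of_ne_zero (by rintro rfl; simp at hs; omega)
  have hu0 : 0 < u := Nat.pos_of_ne_zero (by rintro rfl; simp at hu; omega)
  have hs' : Nat.lcm n p / n = s := by rw [ht, ← hs, Nat.mul_div_cancel_left _ hn0]
  have hu' : Nat.lcm n p / p = u := by rw [ht, ← hu, Nat.mul_div_cancel_left _ hp0]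
  subst hs' hu' ht
  by_cases h : r < m * (Nat.lcm n p / n) ∧ c < q * (Nat.lcm n p / p)
  · rw [zeroExt, dif_pos h, stp, Matrix.mul_apply, Finset.sum_range]
    refine Finset.sum_congr rfl fun k _ => ?_
    have hk1 : (k : ℕ) / (Nat.lcm n p / n) < n :=
      (Nat.div_lt_iff_lt_mul hs0).2 (by rw [hs]; exact k.2)
    have hk2 : (k : ℕ) / (Nat.lcm n p / p) < p :=
      (Nat.div_lt_iff_lt_mul hu0).2 (by rw [hu]; exact k.2)
    have hr : r / (Nat.lcm n p / n) < m := (Nat.div_lt_iff_lt_mul hs0).2 h.1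
    have hc : c / (Nat.lcm n p / p) < q := (Nat.div_lt_iff_lt_mul hu0).2 h.2
    simp [zeroExt, hk1, hk2, hr, hc, Matrix.one_apply, Fin.ext_iff, Fin.divNat, Fin.modNat]
  · rw [zeroExt, dif_neg h, Finset.sum_eq_zero]
    intro k _
    rcases not_and_or.1 h with h | h
    · have : ¬ r / (Nat.lcm n p / n) < m := fun h' => h ((Nat.div_lt_iff_lt_mul hs0).1 h')
      simp [zeroExt, this]
    · have : ¬ c / (Nat.lcm n p / p) < q := fun h' => h ((Nat.div_lt_iff_lt_mul hu0).1 h')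
      simp [zeroExt, this]

/-- Every column of `A` is a standard basis vector, the `c`-th being `δ^{f c}`. -/
def IsLogical {m n : ℕ} (A : Matrix (Fin m) (Fin n) ℝ) (f : ℕ → ℕ) : Prop :=
  ∀ c < n, f c < m ∧ ∀ r, zeroExt A r c = if r = f c then 1 else 0

theorem isLogical_of_apply {m n : ℕ} {A : Matrix (Fin m) (Fin n) ℝ} {f : ℕ → ℕ}
    (hf : ∀ c < n, f c < m) (h : ∀ i j, A i j = if (i : ℕ) = f j then 1 else 0) :
    IsLogical A f := by
  refine fun c hc => ⟨hf c hc, fun r => ?_⟩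
  by_cases hr : r < m
  · simp [zeroExt, hr, hc, h]
  · have : r ≠ f c := fun e => hr (e ▸ hf c hc)
    simp [zeroExt, hr, this]

theorem IsLogical.congr {m n : ℕ} {A : Matrix (Fin m) (Fin n) ℝ} {f g : ℕ → ℕ}
    (h : IsLogical A f) (hfg : ∀ c < n, f c = g c) : IsLogical A g := by
  intro c hc
  rw [← hfg c hc]
  exact h c hc

theorem IsLogical.reindex {m n m' n' : ℕ} {A : Matrix (Fin m) (Fin n) ℝ} {f : ℕ → ℕ}
    (h : IsLogical A f) (hm : m = m') (hn : n = n') :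
    IsLogical (Matrix.reindex (finCongr hm) (finCongr hn) A) f := by
  subst hm hn
  exact h

theorem IsLogical.stp {m n p q s : ℕ} {A : Matrix (Fin m) (Fin n) ℝ}
    {B : Matrix (Fin p) (Fin q) ℝ} {f g : ℕ → ℕ} (hA : IsLogical A f) (hB : IsLogical B g)
    (hs : n * s = p) (hp : 0 < p) :
    IsLogical (stp A B) (fun c => f (g c / s) * s + g c % s) := by
  have hlcm : Nat.lcm n p = p := lcm_eq_right_of_dvd ⟨s, hs.symm⟩
  have hn0 : 0 < n := Nat.pos_of_ne_zero (by rintro rfl; simp at hs; omega)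
  have hs0 : 0 < s := Nat.pos_of_ne_zero (by rintro rfl; simp at hs; omega)
  have hdiv : Nat.lcm n p / n = s := by rw [hlcm, ← hs, Nat.mul_div_cancel_left _ hn0]
  intro c hc
  rw [hlcm, Nat.div_self hp, mul_one] at hc
  obtain ⟨hg, hBc⟩ := hB c hc
  obtain ⟨hf, hAc⟩ := hA (g c / s) ((Nat.div_lt_iff_lt_mul hs0).2 (by rwa [hs]))
  have hmod : g c % s < s := Nat.mod_lt _ hs0
  refine ⟨?_, fun r => ?_⟩
  · rw [hdiv]
    nlinarith
  · rw [zeroExt_stp A B hlcm hs (mul_one p) hp, Finset.sum_eq_single (g c)]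
    · simp only [Nat.mod_one, Nat.div_one, hAc, hBc, if_true, mul_one]
      rw [← ite_and]
      congr 1
      refine propext ⟨fun h => ?_, fun h => ?_⟩
      · rw [← h.2, ← h.1, Nat.div_add_mod']
      · subst h
        refine ⟨by simp [Nat.add_mod], ?_⟩
        rw [mul_comm, Nat.mul_add_div hs0, Nat.div_eq_of_lt hmod, add_zero]
    · intro k _ hk
      simp [hBc, hk]
    · simp [hg]

theorem isLogical_swapMatrix {m n : ℕ} :
    IsLogical (swapMatrix m n) (fun c => c % n * m + c / n) := by
  refine isLogical_of_apply (fun c hc => ?_) fun i j => rfl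
  have hn : 0 < n := Nat.pos_of_ne_zero (by rintro rfl; simp at hc)
  have h1 := Nat.mod_lt c hn
  have h2 : c / n < m := (Nat.div_lt_iff_lt_mul hn).2 hc
  nlinarith

theorem mul_add_div_of_lt {K a : ℕ} (x : ℕ) (ha : a < K) : (x * K + a) / K = x := by
  rw [mul_comm, Nat.mul_add_div (by omega), Nat.div_eq_of_lt ha, add_zero]

theorem mul_add_mod_of_lt {K a : ℕ} (x : ℕ) (ha : a < K) : (x * K + a) % K = a := by
  rw [mul_comm, Nat.mul_add_mod, Nat.mod_eq_of_lt ha]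

/-- The permutation underlying the action of `I ⊗ W_{[K,N]}` on standard basis vectors. -/
def blockSwap (K N c : ℕ) : ℕ :=
  c / (K * N) * (K * N) + (c % N * K + c / N % K)

theorem blockSwap_apply {K N a b : ℕ} (α : ℕ) (ha : a < K) (hb : b < N) :
    blockSwap K N ((α * K + a) * N + b) = (α * N + b) * K + a := by
  rw [blockSwap, mul_comm K N, ← Nat.div_div_eq_div_mul, mul_add_div_of_lt _ hb,
    mul_add_mod_of_lt _ hb, mul_add_div_of_lt _ ha, mul_add_mod_of_lt _ ha]
  ring

theorem isLogical_swapFactor (n i : ℕ) :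
    IsLogical (swapFactor n i) (blockSwap 2 (2 ^ n)) := by
  suffices h : IsLogical (swapFactor n i) (fun c => c / (2 * 2 ^ n) * (2 * 2 ^ n) +
      (c % (2 * 2 ^ n) % 2 ^ n * 2 + c % (2 * 2 ^ n) / 2 ^ n)) from
    h.congr fun c _ => by rw [blockSwap, Nat.mod_mul_left_mod, Nat.mod_mul_left_div_self]
  have hN : 0 < 2 * 2 ^ n := by positivity
  have hσ : ∀ c, c % (2 * 2 ^ n) % 2 ^ n * 2 + c % (2 * 2 ^ n) / 2 ^ n < 2 * 2 ^ n :=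
    fun c => (isLogical_swapMatrix (m := 2) (n := 2 ^ n) _ (Nat.mod_lt c hN)).1
  refine isLogical_of_apply (fun c hc => ?_) fun r c => ?_
  · have h1 : c / (2 * 2 ^ n) < 2 ^ i := (Nat.div_lt_iff_lt_mul hN).2 hc
    have h2 := hσ c
    nlinarith
  · have h2 := hσ c
    simp only [swapFactor, swapMatrix, Matrix.reindex_apply, Matrix.submatrix_apply,
      Matrix.kroneckerMap_apply, Matrix.one_apply, finProdFinEquiv_symm_apply, Fin.ext_iff,
      Fin.coe_divNat, Fin.coe_modNat, Matrix.of_apply, ite_mul, one_mul, zero_mul]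
    have key : (r : ℕ) = c / (2 * 2 ^ n) * (2 * 2 ^ n) +
        (c % (2 * 2 ^ n) % 2 ^ n * 2 + c % (2 * 2 ^ n) / 2 ^ n) ↔
        (r : ℕ) / (2 * 2 ^ n) = c / (2 * 2 ^ n) ∧
          (r : ℕ) % (2 * 2 ^ n) = c % (2 * 2 ^ n) % 2 ^ n * 2 + c % (2 * 2 ^ n) / 2 ^ n := by
      refine ⟨fun h => ?_, fun h => ?_⟩
      · rw [h]
        exact ⟨mul_add_div_of_lt _ h2, mul_add_mod_of_lt _ h2⟩
      · rw [← h.1, ← h.2, Nat.div_add_mod']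
    rw [if_congr key rfl rfl, ite_and]
    rfl

/-- `∏_{i=1}^{k} (I_{2ⁱ} ⊗ W_{[2,2ⁿ]}) = I₂ ⊗ W_{[2ᵏ,2ⁿ]}`. -/
theorem isLogical_bigSwapProd (n k : ℕ) :
    IsLogical (bigSwapProd n k) (blockSwap (2 ^ k) (2 ^ n)) := by
  induction k with
  | zero =>
    have h : IsLogical (bigSwapProd n 0) id := by
      refine isLogical_of_apply (fun c hc => hc) fun i j => ?_
      simp [bigSwapProd, Matrix.one_apply, Fin.ext_iff]
    refine h.congr fun c _ => ?_
    simp [blockSwap, Nat.mod_one, Nat.div_add_mod']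
  | succ k ih =>
    have h := ih.stp (isLogical_swapFactor n (k + 1)) (s := 2) (by ring) (by positivity)
    refine (IsLogical.reindex h _ _).congr fun c _ => ?_
    have hN : 0 < 2 ^ n := by positivity
    have hK : 0 < 2 ^ k := by positivity
    rw [pow_succ]
    generalize 2 ^ n = N at hN ⊢
    generalize 2 ^ k = K at hK ⊢
    obtain ⟨α, a, b, e, ha, hb, he, rfl⟩ : ∃ α a b e, a < K ∧ b < N ∧ e < 2 ∧
        c = ((α * K + a) * 2 + e) * N + b := by
      refine ⟨c / N / 2 / K, c / N / 2 % K, c % N, c / N % 2, Nat.mod_lt _ hK, Nat.mod_lt _ hN,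
        Nat.mod_lt _ two_pos, ?_⟩
      rw [Nat.div_add_mod', Nat.div_add_mod', Nat.div_add_mod']
    have h1 : (((α * K + a) * N + b) * 2 + e) / 2 = (α * K + a) * N + b := by omega
    have h2 : (((α * K + a) * N + b) * 2 + e) % 2 = e := by omega
    have h3 : ((α * K + a) * 2 + e) * N + b = (α * (K * 2) + (a * 2 + e)) * N + b := by ring
    rw [blockSwap_apply _ he hb, h1, h2, blockSwap_apply _ ha hb, h3,
      blockSwap_apply _ (by omega) hb]
    ring

/-- `W_{[2,2ⁿ]} ⋉ ∏_{i=1}^{k} (I_{2ⁱ} ⊗ W_{[2,2ⁿ]}) = W_{[2ᵏ⁺¹,2ⁿ]}`. -/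
theorem isLogical_swapMatrix_stp_bigSwapProd (n k : ℕ) :
    IsLogical (stp (swapMatrix 2 (2 ^ n)) (bigSwapProd n k))
      (fun c => c % 2 ^ n * 2 ^ (k + 1) + c / 2 ^ n) := by
  have h := (isLogical_swapMatrix (m := 2) (n := 2 ^ n)).stp (isLogical_bigSwapProd n k)
    (s := 2 ^ k) (by ring) (by positivity)
  refine h.congr fun c _ => ?_
  have hN : 0 < 2 ^ n := by positivity
  have hK : 0 < 2 ^ k := by positivity
  rw [pow_succ]
  generalize 2 ^ n = N at hN ⊢
  generalize 2 ^ k = K at hK ⊢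
  obtain ⟨α, a, b, ha, hb, rfl⟩ : ∃ α a b, a < K ∧ b < N ∧ c = (α * K + a) * N + b := by
    refine ⟨c / N / K, c / N % K, c % N, Nat.mod_lt _ hK, Nat.mod_lt _ hN, ?_⟩
    rw [Nat.div_add_mod', Nat.div_add_mod']
  rw [blockSwap_apply _ ha hb, mul_add_div_of_lt _ ha, mul_add_mod_of_lt _ ha,
    mul_add_div_of_lt _ hb, mul_add_mod_of_lt _ hb, mul_add_div_of_lt _ hb,
    mul_add_mod_of_lt _ hb]
  ring

/-- A matrix acting as `W_{[K,N]}` swaps the two factors of a product of column vectors. -/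
theorem stp_eq_of_isLogical {K N R C : ℕ} (hK : 0 < K) (hN : 0 < N) (hR : R = N * K)
    (hC : C = K * N) {M : Matrix (Fin R) (Fin C) ℝ}
    (hM : IsLogical M (fun c => c % N * K + c / N))
    (x : Matrix (Fin N) (Fin 1) ℝ) (y : Matrix (Fin K) (Fin 1) ℝ) :
    HEq (stp x y) (stp (stp M y) x) := by
  subst hR hC
  have hKN : 0 < K * N := Nat.mul_pos hK hN
  have hl1 : Nat.lcm (K * N) K = K * N := by
    rw [Nat.lcm_comm, lcm_eq_right_of_dvd (Dvd.intro N rfl)]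
  have hd1 : 1 * (Nat.lcm (K * N) K / K) = N := by
    rw [hl1, Nat.mul_div_cancel_left _ hK, one_mul]
  have hl2 : Nat.lcm (1 * (Nat.lcm (K * N) K / K)) N = N := by rw [hd1, Nat.lcm_self]
  refine heq_of_zeroExt ?_ ?_ fun r hr c hc => ?_
  · rw [hl2, hd1, hl1, Nat.lcm_one_left, Nat.div_one, Nat.div_self hKN, Nat.div_self hN]
    ring
  · rw [hl2, Nat.lcm_one_left, Nat.div_self hK, Nat.div_self hN]
  · rw [Nat.lcm_one_left, Nat.div_one] at hr
    rw [Nat.lcm_one_left, Nat.div_self hK, mul_one, Nat.lt_one_iff] at hc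
    subst hc
    have hrK : r / K < N := (Nat.div_lt_iff_lt_mul hK).2 hr
    have hrm : r % K < K := Nat.mod_lt _ hK
    rw [zeroExt_stp x y (Nat.lcm_one_left K) (one_mul K) (mul_one K) hK,
      zeroExt_stp (stp M y) x hl2 (by rw [hd1, mul_one]) (mul_one N) hN]
    have hMy : ∀ j < N, zeroExt (stp M y) r j =
        if j = r / K then zeroExt y (r % K) 0 else 0 := by
      intro j hj
      rw [zeroExt_stp M y hl1 (mul_one _) rfl hKN,
        Finset.sum_eq_single (r % K * N + r / K)]
      · have := (hM (r % K * N + r / K) (by nlinarith)).2 r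
        simp only [mul_add_mod_of_lt _ hrK, mul_add_div_of_lt _ hrK, Nat.div_add_mod',
          if_true] at this
        simp [Nat.mod_one, this, mul_add_mod_of_lt _ hrK, mul_add_div_of_lt _ hrK,
          Nat.mod_eq_of_lt hj, Nat.div_eq_of_lt hj, eq_comm]
      · intro i hi hne
        have := (hM i (Finset.mem_range.1 hi)).2 r
        have hri : r ≠ i % N * K + i / N := by
          rintro rfl
          have hiK : i / N < K := (Nat.div_lt_iff_lt_mul hN).2 (Finset.mem_range.1 hi)
          rw [mul_add_mod_of_lt _ hiK, mul_add_div_of_lt _ hiK, Nat.div_add_mod'] at hne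
          exact hne rfl
        simp [this, hri]
      · intro h
        exact absurd (Finset.mem_range.2 (by nlinarith)) h
    rw [Finset.sum_eq_single (r % K), Finset.sum_eq_single (r / K)]
    · simp [Nat.mod_one, hMy _ hrK, Nat.div_eq_of_lt hrm, mul_comm]
    · intro j hj hne
      simp [hMy j (Finset.mem_range.1 hj), hne]
    · intro h
      exact absurd (Finset.mem_range.2 hrK) h
    · intro j hj hne
      simp [Nat.mod_eq_of_lt (Finset.mem_range.1 hj), hne.symm]
    · intro h
      exact absurd (Finset.mem_range.2 hrm) h

/-- The block-rearrangement identity of the state-transition derivation: for column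
vectors `p₁, …, pₙ, q₁, …, q_m ∈ ℝ²` (with `m ≥ 1`),
`p₁ ⋉ ⋯ ⋉ pₙ ⋉ q₁ ⋉ ⋯ ⋉ q_m
  = W_{[2,2ⁿ]} ⋉ (∏_{i=1}^{m−1} (I_{2ⁱ} ⊗ W_{[2,2ⁿ]})) ⋉ q₁ ⋉ ⋯ ⋉ q_m ⋉ p₁ ⋉ ⋯ ⋉ pₙ`
(heterogeneous equality, the two sides having equal dimensions). -/
theorem block_rearrangement {n m : ℕ} (hm : 1 ≤ m)
    (P : Fin n → Matrix (Fin 2) (Fin 1) ℝ) (Q : Fin m → Matrix (Fin 2) (Fin 1) ℝ) :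
    HEq (stp (stpVecs n P) (stpVecs m Q))
      (stp (stp (stp (swapMatrix 2 (2 ^ n)) (bigSwapProd n (m - 1)))
        (stpVecs m Q)) (stpVecs n P)) := by
  obtain ⟨k, rfl⟩ : ∃ k, m = k + 1 := ⟨m - 1, by omega⟩
  have hM := isLogical_swapMatrix_stp_bigSwapProd n k
  have hrow : 2 * 2 ^ n * (Nat.lcm (2 * 2 ^ n) (2 ^ (n + 1) * 2 ^ k) / (2 * 2 ^ n)) =
      2 ^ n * 2 ^ (k + 1) := by
    rw [Nat.mul_div_cancel' (Nat.dvd_lcm_left _ _), lcm_eq_right_of_dvd ⟨2 ^ k, by ring⟩]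
    ring
  have hcol : 2 ^ (n + 1) * 2 ^ k *
      (Nat.lcm (2 * 2 ^ n) (2 ^ (n + 1) * 2 ^ k) / (2 ^ (n + 1) * 2 ^ k)) =
      2 ^ (k + 1) * 2 ^ n := by
    rw [Nat.mul_div_cancel' (Nat.dvd_lcm_right _ _), lcm_eq_right_of_dvd ⟨2 ^ k, by ring⟩]
    ring
  exact stp_eq_of_isLogical (by positivity) (by positivity) hrow hcol hM _ _
end
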